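/- Let N ≥ 2 and let r, s be integers with s ≥ 1 and s + 1 ≤ r < N. Let U = diag(u₀,…,u₀ (r times), u₁,…,u_{N−r}) and V = diag(v₀,…,v₀ (N−s times), v₁,…,v_s) be real diagonal N×N matrices, with the uᵢ's and vⱼ's arbitrary real numbers. Then for every k ∈ SO(N), the value u₀ + v₀ occurs with multiplicity at least r − s among the logarithms of the singular values of the matrix e^U k e^V (i.e., among the N numbers (1/2)·log of the eigenvalues of (e^U k e^V)ᵀ(e^U k e^V)). -/

import Mathlib

open Matrix

theorem rank_diag_le_aux (N r : ℕ) (hr : r ≤ N) (w : Fin N → ℝ)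
    (hw : ∀ i : Fin N, (i : ℕ) < r → w i = 0) : (Matrix.diagonal w).rank ≤ N - r := by
  classical
  rw [Matrix.rank_diagonal, Fintype.card_subtype]
  have h1 : (Finset.univ.filter fun i : Fin N => w i ≠ 0) ⊆
      (Finset.univ.filter fun i : Fin N => ¬ ((i : ℕ) < r)) := by
    intro i hi
    simp only [Finset.mem_filter, Finset.mem_univ, true_and] at hi ⊢
    exact fun h => hi (hw i h)
  have h2 := Finset.card_le_card h1
  have h3 := Finset.card_filter_add_card_filter_not (s := (Finset.univ : Finset (Fin N)))
    (fun i : Fin N => (i : ℕ) < r)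
  have h4 : (Finset.univ.filter fun i : Fin N => (i : ℕ) < r).card = r := by
    rw [Fin.card_filter_val_lt]; omega
  rw [Finset.card_univ, Fintype.card_fin] at h3
  omega

theorem rank_herm_aux {N : ℕ} (M : Matrix (Fin N) (Fin N) ℝ) (hM : M.IsHermitian) (l : ℝ) :
    N ≤ (M - l • (1 : Matrix (Fin N) (Fin N) ℝ)).rank +
      (Finset.univ.filter fun i => hM.eigenvalues i = l).card := by
  classical
  have hU := hM.spectral_theorem
  rw [Unitary.conjStarAlgAut_apply] at hU
  set P := hM.eigenvectorUnitary
  have h1 : Matrix.diagonal (fun i => hM.eigenvalues i - l) =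
      (star P : Matrix (Fin N) (Fin N) ℝ) * (M - l • (1 : Matrix (Fin N) (Fin N) ℝ)) * P := by
    have hP : (star P : Matrix (Fin N) (Fin N) ℝ) * (P : Matrix (Fin N) (Fin N) ℝ) = 1 :=
      Unitary.coe_star_mul_self P
    have h2 : (star P : Matrix (Fin N) (Fin N) ℝ) * M * P = Matrix.diagonal hM.eigenvalues := by
      conv_lhs => rw [hU]
      simp only [← mul_assoc, hP, one_mul]
      rw [mul_assoc, hP, mul_one]
      rfl
    rw [mul_sub, sub_mul, h2, Matrix.mul_smul, Matrix.smul_mul, mul_one, hP,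
      ← Matrix.diagonal_one, ← Matrix.diagonal_smul, Matrix.diagonal_sub]
    congr 1; ext i; simp
  have h3 : (Matrix.diagonal (fun i => hM.eigenvalues i - l)).rank ≤
      (M - l • (1 : Matrix (Fin N) (Fin N) ℝ)).rank := by
    rw [h1]
    exact (Matrix.rank_mul_le_left _ _).trans (Matrix.rank_mul_le_right _ _)
  rw [Matrix.rank_diagonal, Fintype.card_subtype] at h3
  have h4 := Finset.card_filter_add_card_filter_not (s := (Finset.univ : Finset (Fin N)))
    (fun i => hM.eigenvalues i = l)
  rw [Finset.card_univ, Fintype.card_fin] at h4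
  simp only [sub_ne_zero] at h3
  simp only [ne_eq] at h3
  omega

theorem rank_add_le_aux {N : ℕ} (A B : Matrix (Fin N) (Fin N) ℝ) :
    (A + B).rank ≤ A.rank + B.rank := by
  unfold Matrix.rank
  rw [Matrix.mulVecLin_add]
  refine le_trans (Submodule.finrank_mono ?_)
    (Submodule.finrank_add_le_finrank_add_finrank
      (LinearMap.range A.mulVecLin) (LinearMap.range B.mulVecLin))
  rintro _ ⟨x, rfl⟩
  exact Submodule.add_mem_sup ⟨x, rfl⟩ ⟨x, rfl⟩

/-- Let `N ≥ 2`, `s ≥ 1`, `s + 1 ≤ r < N`. Let `U = diag(u₀,…,u₀ (r times), u₁,…,u_{N-r})` and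
`V = diag(v₀,…,v₀ (N-s times), v₁,…,v_s)` be real diagonal `N × N` matrices (given by their
diagonals `u`, `v : Fin N → ℝ`, constantly `u₀` on the first `r` entries, resp. constantly `v₀`
on the first `N - s` entries). Then for every `k ∈ SO(N)`, the value `u₀ + v₀` occurs with
multiplicity at least `r - s` among the logarithms of the singular values of `e^U k e^V`,
i.e. among the `N` numbers `(1/2)·log` of the eigenvalues (with multiplicity) of
`(e^U k e^V)ᵀ (e^U k e^V)`. -/
theorem repeated_log_singular_values
    (N r s : ℕ) (hN : 2 ≤ N) (hs : 1 ≤ s) (hsr : s + 1 ≤ r) (hrN : r < N)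
    (u₀ v₀ : ℝ) (u v : Fin N → ℝ)
    (hu : ∀ i : Fin N, (i : ℕ) < r → u i = u₀)
    (hv : ∀ i : Fin N, (i : ℕ) < N - s → v i = v₀)
    (k : Matrix (Fin N) (Fin N) ℝ) (hk : kᵀ * k = 1) (hkdet : k.det = 1)
    (g : Matrix (Fin N) (Fin N) ℝ)
    (hg : g = Matrix.diagonal (fun i => Real.exp (u i)) * k *
      Matrix.diagonal (fun i => Real.exp (v i)))
    (hM : (gᵀ * g).IsHermitian) :
    r - s ≤ (Finset.univ.filter fun i =>
      (1 / 2 : ℝ) * Real.log (hM.eigenvalues i) = u₀ + v₀).card := by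
  have key := rank_herm_aux (gᵀ * g) hM (Real.exp (u₀ + v₀) ^ 2)
  have hsub : (Finset.univ.filter fun i => hM.eigenvalues i = Real.exp (u₀ + v₀) ^ 2).card ≤
      (Finset.univ.filter fun i =>
        (1 / 2 : ℝ) * Real.log (hM.eigenvalues i) = u₀ + v₀).card := by
    apply Finset.card_le_card
    intro i hi
    simp only [Finset.mem_filter, Finset.mem_univ, true_and] at hi ⊢
    rw [hi, Real.log_pow, Real.log_exp]
    push_cast
    ring
  have hA := rank_diag_le_aux N r hrN.le (fun i => Real.exp (u i) ^ 2 - Real.exp u₀ ^ 2)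
    (fun i hi => by simp [hu i hi])
  have hB := rank_diag_le_aux N (N - s) (by omega)
    (fun i => Real.exp u₀ ^ 2 * (Real.exp (v i) ^ 2 - Real.exp v₀ ^ 2))
    (fun i hi => by simp [hv i hi])
  have hdec : gᵀ * g - (Real.exp (u₀ + v₀) ^ 2) • (1 : Matrix (Fin N) (Fin N) ℝ) =
      (Matrix.diagonal (fun i => Real.exp (v i)) * kᵀ) *
        (Matrix.diagonal (fun i => Real.exp (u i) ^ 2 - Real.exp u₀ ^ 2) *
        (k * Matrix.diagonal (fun i => Real.exp (v i)))) +
      Matrix.diagonal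
        (fun i => Real.exp u₀ ^ 2 * (Real.exp (v i) ^ 2 - Real.exp v₀ ^ 2)) := by
    have e1 : Matrix.diagonal (fun i => Real.exp (u i) ^ 2 - Real.exp u₀ ^ 2) =
        Matrix.diagonal (fun i => Real.exp (u i)) * Matrix.diagonal (fun i => Real.exp (u i)) -
          (Real.exp u₀ ^ 2) • (1 : Matrix (Fin N) (Fin N) ℝ) := by
      rw [Matrix.diagonal_mul_diagonal, ← Matrix.diagonal_one, ← Matrix.diagonal_smul,
        Matrix.diagonal_sub]
      congr 1; ext i; simp [sq]
    have e2 : Matrix.diagonal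
        (fun i => Real.exp u₀ ^ 2 * (Real.exp (v i) ^ 2 - Real.exp v₀ ^ 2)) =
        (Real.exp u₀ ^ 2) • (Matrix.diagonal (fun i => Real.exp (v i)) *
          Matrix.diagonal (fun i => Real.exp (v i))) -
          (Real.exp (u₀ + v₀) ^ 2) • (1 : Matrix (Fin N) (Fin N) ℝ) := by
      rw [Matrix.diagonal_mul_diagonal, ← Matrix.diagonal_one, ← Matrix.diagonal_smul,
        ← Matrix.diagonal_smul, Matrix.diagonal_sub]
      congr 1; ext i; simp [Real.exp_add]; ring
    have e3 : Matrix.diagonal (fun i => Real.exp (v i)) * kᵀ *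
        (k * Matrix.diagonal (fun i => Real.exp (v i))) =
        Matrix.diagonal (fun i => Real.exp (v i)) *
          Matrix.diagonal (fun i => Real.exp (v i)) := by
      rw [mul_assoc, ← mul_assoc kᵀ, hk, one_mul]
    rw [e1, e2, sub_mul, mul_sub, Matrix.smul_mul, one_mul, Matrix.mul_smul, e3, hg,
      Matrix.transpose_mul, Matrix.transpose_mul, Matrix.diagonal_transpose,
      Matrix.diagonal_transpose]
    simp only [mul_assoc]
    abel
  have hR := rank_add_le_aux
    ((Matrix.diagonal (fun i => Real.exp (v i)) * kᵀ) *
        (Matrix.diagonal (fun i => Real.exp (u i) ^ 2 - Real.exp u₀ ^ 2) *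
        (k * Matrix.diagonal (fun i => Real.exp (v i)))))
    (Matrix.diagonal
        (fun i => Real.exp u₀ ^ 2 * (Real.exp (v i) ^ 2 - Real.exp v₀ ^ 2)))
  rw [← hdec] at hR
  have hC := (Matrix.rank_mul_le_right (Matrix.diagonal (fun i => Real.exp (v i)) * kᵀ)
        (Matrix.diagonal (fun i => Real.exp (u i) ^ 2 - Real.exp u₀ ^ 2) *
        (k * Matrix.diagonal (fun i => Real.exp (v i))))).trans
        (Matrix.rank_mul_le_left _ _)
  omega
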